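/- arXiv:2208.00291 — 2 statements merged into one kernel-verified Lean document; each statement's English description precedes it below -/
import Mathlib

section
/- Let A be a ring, P a finitely generated projective left A-module, B = End_A(P)^op, F = Hom_A(P, −) : A-Mod → B-Mod, and G = Hom_B(FA, −) : B-Mod → A-Mod its right adjoint. Then for every B-module M the counit ε_M : FG(M) → M of the adjunction F ⊣ G is an isomorphism; in particular G is fully faithful. -/
/-!
Statement 4. Let `A` be a ring, `P` a finitely generated projective left `A`-module,
`B = End_A(P)ᵒᵖ`, `F = Hom_A(P, −) : A-Mod → B-Mod`, and `G = Hom_B(FA, −) : B-Mod → A-Mod`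
its right adjoint.  Then for every `B`-module `M` the counit `ε_M : FG(M) → M` of the
adjunction `F ⊣ G` is an isomorphism; in particular `G` is fully faithful.

Here the counit is characterised (uniquely, since `Φ` is the hom-set bijection of the
adjunction) by the equation `Φ ε_M = id_{G M}`, where
`Φ : Hom_B(F X, M) → Hom_A(X, G M)` is the adjunction map `Φ k x f = k (p ↦ f p • x)`.
-/

open Function

section SchurFramework

variable {A : Type} [Ring A] {P : Type} [AddCommGroup P] [Module A P]

/-- `B = End_A(P)ᵒᵖ`. -/
abbrev Bop (A : Type) [Ring A] (P : Type) [AddCommGroup P] [Module A P] : Type :=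
  (Module.End A P)ᵐᵒᵖ

/-- `F M = Hom_A(P, M)` is a left `B`-module via precomposition. -/
instance instSMulBop (M : Type) [AddCommGroup M] [Module A M] :
    SMul (Bop A P) (P →ₗ[A] M) :=
  ⟨fun b φ => φ.comp b.unop⟩

@[simp] lemma smulBop_apply {M : Type} [AddCommGroup M] [Module A M]
    (b : Bop A P) (φ : P →ₗ[A] M) (p : P) : (b • φ) p = φ (b.unop p) := rfl

instance instModuleBop (M : Type) [AddCommGroup M] [Module A M] :
    Module (Bop A P) (P →ₗ[A] M) where
  one_smul φ := LinearMap.ext fun p => rfl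
  mul_smul b c φ := LinearMap.ext fun p => rfl
  smul_zero b := rfl
  smul_add b φ ψ := rfl
  add_smul b c φ := LinearMap.ext fun p => by
    simp only [smulBop_apply, MulOpposite.unop_add, LinearMap.add_apply, map_add]
  zero_smul φ := LinearMap.ext fun p => by
    simp only [smulBop_apply, MulOpposite.unop_zero, LinearMap.zero_apply, map_zero,
      LinearMap.zero_apply]

/-- Right multiplication by `a` on `F A = Hom_A(P, A)`, as a `B`-linear endomorphism.
This gives `F A` its right `A`-module structure. -/
def rmulA (a : A) : (P →ₗ[A] A) →ₗ[Bop A P] (P →ₗ[A] A) where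
  toFun f :=
    { toFun := fun p => f p * a
      map_add' := fun p q => by simp [add_mul]
      map_smul' := fun c p => by simp [smul_eq_mul, mul_assoc] }
  map_add' f g := LinearMap.ext fun p => by simp [add_mul]
  map_smul' b f := LinearMap.ext fun p => rfl

@[simp] lemma rmulA_apply (a : A) (f : P →ₗ[A] A) (p : P) : rmulA a f p = f p * a := rfl

lemma rmulA_one : (rmulA (A := A) (P := P) 1) = LinearMap.id :=
  LinearMap.ext fun f => LinearMap.ext fun p => by simp

lemma rmulA_mul (a b : A) :
    (rmulA (A := A) (P := P) (a * b)) = (rmulA b).comp (rmulA a) :=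
  LinearMap.ext fun f => LinearMap.ext fun p => by simp [mul_assoc]

lemma rmulA_add (a b : A) :
    (rmulA (A := A) (P := P) (a + b)) = rmulA a + rmulA b :=
  LinearMap.ext fun f => LinearMap.ext fun p => by simp [mul_add]

lemma rmulA_zero : (rmulA (A := A) (P := P) 0) = 0 :=
  LinearMap.ext fun f => LinearMap.ext fun p => by simp

/-- `G N = Hom_B(FA, N)` is a left `A`-module, via the right `A`-module structure of `FA`. -/
instance instSMulGA (N : Type) [AddCommGroup N] [Module (Bop A P) N] :
    SMul A ((P →ₗ[A] A) →ₗ[Bop A P] N) :=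
  ⟨fun a g => g.comp (rmulA a)⟩

@[simp] lemma smulGA_apply {N : Type} [AddCommGroup N] [Module (Bop A P) N]
    (a : A) (g : (P →ₗ[A] A) →ₗ[Bop A P] N) (f : P →ₗ[A] A) :
    (a • g) f = g (rmulA a f) := rfl

instance instModuleGA (N : Type) [AddCommGroup N] [Module (Bop A P) N] :
    Module A ((P →ₗ[A] A) →ₗ[Bop A P] N) where
  one_smul g := show g.comp (rmulA 1) = g by rw [rmulA_one, LinearMap.comp_id]
  mul_smul a b g := show g.comp (rmulA (a * b)) = (g.comp (rmulA b)).comp (rmulA a) by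
    rw [rmulA_mul, LinearMap.comp_assoc]
  smul_zero a := LinearMap.zero_comp _
  smul_add a g h := LinearMap.add_comp _ _ _
  add_smul a b g := show g.comp (rmulA (a + b)) = g.comp (rmulA a) + g.comp (rmulA b) by
    rw [rmulA_add, LinearMap.comp_add]
  zero_smul g := show g.comp (rmulA 0) = 0 by rw [rmulA_zero, LinearMap.comp_zero]

/-- For `f ∈ Hom_A(P, A)` and `x ∈ X`, the map `p ↦ f p • x`, an element of `F X`. -/
def starMap {X : Type} [AddCommGroup X] [Module A X] (f : P →ₗ[A] A) (x : X) :
    P →ₗ[A] X where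
  toFun p := f p • x
  map_add' p q := by simp [add_smul]
  map_smul' a p := by simp [smul_eq_mul, mul_smul]

@[simp] lemma starMap_apply {X : Type} [AddCommGroup X] [Module A X]
    (f : P →ₗ[A] A) (x : X) (p : P) : starMap f x p = f p • x := rfl

lemma starMap_addl {X : Type} [AddCommGroup X] [Module A X] (f g : P →ₗ[A] A) (x : X) :
    starMap (f + g) x = starMap f x + starMap g x :=
  LinearMap.ext fun p => by simp [add_smul]

lemma starMap_smulB {X : Type} [AddCommGroup X] [Module A X] (b : Bop A P)
    (f : P →ₗ[A] A) (x : X) : starMap (b • f) x = b • starMap f x :=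
  LinearMap.ext fun p => rfl

lemma starMap_smulA {X : Type} [AddCommGroup X] [Module A X] (a : A)
    (f : P →ₗ[A] A) (x : X) : starMap f (a • x) = starMap (rmulA a f) x :=
  LinearMap.ext fun p => by simp [mul_smul]

/-- The adjunction bijection `Φ : Hom_B(F X, M) → Hom_A(X, G M)` of `F ⊣ G`. -/
def PhiAdj {X : Type} [AddCommGroup X] [Module A X]
    {M : Type} [AddCommGroup M] [Module (Bop A P) M]
    (k : (P →ₗ[A] X) →ₗ[Bop A P] M) :
    X →ₗ[A] ((P →ₗ[A] A) →ₗ[Bop A P] M) where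
  toFun x :=
    { toFun := fun f => k (starMap f x)
      map_add' := fun f g => by
        show k (starMap (f + g) x) = k (starMap f x) + k (starMap g x)
        rw [starMap_addl, map_add]
      map_smul' := fun b f => by
        show k (starMap (b • f) x) = b • k (starMap f x)
        rw [starMap_smulB, map_smul] }
  map_add' x y := LinearMap.ext fun f => by
    have : starMap f (x + y) = starMap f x + starMap f y :=
      LinearMap.ext fun p => by simp [smul_add]
    simp [this]
  map_smul' a x := LinearMap.ext fun f => by
    simp [starMap_smulA]

/-- `G` on morphisms: post-composition. -/
def Gmap {M N : Type} [AddCommGroup M] [Module (Bop A P) M]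
    [AddCommGroup N] [Module (Bop A P) N] (g : M →ₗ[Bop A P] N) :
    ((P →ₗ[A] A) →ₗ[Bop A P] M) →ₗ[A] ((P →ₗ[A] A) →ₗ[Bop A P] N) where
  toFun φ := g.comp φ
  map_add' φ ψ := LinearMap.ext fun f => by simp
  map_smul' a φ := LinearMap.ext fun f => rfl

end SchurFramework

section DualBasis

variable {A : Type} [Ring A] {P : Type} [AddCommGroup P] [Module A P]

/-- A finitely generated projective module has a finite dual basis. -/
lemma exists_finite_dual_basis [Module.Finite A P] [Module.Projective A P] :
    ∃ (n : ℕ) (e : Fin n → P) (c : Fin n → P →ₗ[A] A), ∀ p, ∑ i, c i p • e i = p := by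
  obtain ⟨n, π, hπ⟩ := Module.Finite.exists_fin' A P
  obtain ⟨s, hs⟩ := Module.projective_lifting_property π LinearMap.id hπ
  refine ⟨n, fun i => π (Pi.single i 1), fun i => (LinearMap.proj i).comp s, fun p => ?_⟩
  have hp : π (s p) = p := LinearMap.congr_fun hs p
  conv_rhs => rw [← hp, pi_eq_sum_univ' (s p), map_sum]
  refine Finset.sum_congr rfl fun i _ => ?_
  rw [map_smul]
  congr 2

variable {n : ℕ} {e : Fin n → P} {c : Fin n → P →ₗ[A] A}

lemma sum_rmulA_dual_basis (h : ∀ p, ∑ i, c i p • e i = p) (f : P →ₗ[A] A) :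
    ∑ i, rmulA (f (e i)) (c i) = f :=
  LinearMap.ext fun p => by
    conv_rhs => rw [← h p, map_sum]
    simp [LinearMap.sum_apply]

/-- `F` on morphisms: post-composition. -/
def Fmap {X Y : Type} [AddCommGroup X] [Module A X] [AddCommGroup Y] [Module A Y]
    (ψ : X →ₗ[A] Y) : (P →ₗ[A] X) →ₗ[Bop A P] (P →ₗ[A] Y) where
  toFun φ := ψ.comp φ
  map_add' _ _ := LinearMap.comp_add _ _ _
  map_smul' _ _ := rfl

lemma Fmap_starMap {X Y : Type} [AddCommGroup X] [Module A X] [AddCommGroup Y] [Module A Y]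
    (ψ : X →ₗ[A] Y) (f : P →ₗ[A] A) (x : X) :
    Fmap ψ (starMap f x) = starMap f (ψ x) :=
  LinearMap.ext fun p => map_smul ψ (f p) x

variable {M : Type} [AddCommGroup M] [Module (Bop A P) M]

/-- The counit `F G M → M` computed in a dual basis: `φ ↦ ∑ i, φ (e i) (c i)`. -/
def dualBasisCounit (h : ∀ p, ∑ i, c i p • e i = p) :
    (P →ₗ[A] ((P →ₗ[A] A) →ₗ[Bop A P] M)) →ₗ[Bop A P] M where
  toFun φ := ∑ i, φ (e i) (c i)
  map_add' φ χ := by simp [Finset.sum_add_distrib]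
  map_smul' b φ := by
    have expand (i : Fin n) :
        φ (b.unop (e i)) (c i) = ∑ j, φ (e j) (rmulA (c j (b.unop (e i))) (c i)) := by
      conv_lhs => rw [← h (b.unop (e i)), map_sum, LinearMap.sum_apply]
      simp only [map_smul, smulGA_apply]
    simp only [smulBop_apply, RingHom.id_apply, expand, Finset.smul_sum]
    rw [Finset.sum_comm]
    refine Finset.sum_congr rfl fun j _ => ?_
    rw [← map_sum, ← map_smul]
    exact congrArg _ (sum_rmulA_dual_basis h (b • c j))

lemma dualBasisCounit_apply (h : ∀ p, ∑ i, c i p • e i = p)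
    (φ : P →ₗ[A] ((P →ₗ[A] A) →ₗ[Bop A P] M)) :
    dualBasisCounit h φ = ∑ i, φ (e i) (c i) := rfl

lemma dualBasisCounit_starMap (h : ∀ p, ∑ i, c i p • e i = p) (f : P →ₗ[A] A)
    (x : (P →ₗ[A] A) →ₗ[Bop A P] M) : dualBasisCounit h (starMap f x) = x f := by
  simp only [dualBasisCounit_apply, starMap_apply, smulGA_apply]
  rw [← map_sum, sum_rmulA_dual_basis h]

lemma op_starMap_smul_dualBasisCounit (h : ∀ p, ∑ i, c i p • e i = p) (f : P →ₗ[A] A) (p : P)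
    (φ : P →ₗ[A] ((P →ₗ[A] A) →ₗ[Bop A P] M)) :
    (MulOpposite.op (starMap f p) : Bop A P) • dualBasisCounit h φ = φ p f := by
  rw [← map_smul, ← dualBasisCounit_starMap h f (φ p)]
  exact congrArg _ (LinearMap.ext fun q => map_smul φ (f q) p)

/-- The map `M → F G M` sending `m` to `p ↦ f ↦ (q ↦ f q • p) • m`. -/
def toFG (m : M) : P →ₗ[A] ((P →ₗ[A] A) →ₗ[Bop A P] M) :=
  PhiAdj (LinearMap.toSpanSingleton (Bop A P) M m ∘ₗ
    { toFun := fun g : P →ₗ[A] P => (MulOpposite.op g : Bop A P)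
      map_add' := fun _ _ => rfl
      map_smul' := fun _ _ => rfl })

lemma toFG_apply (m : M) (p : P) (f : P →ₗ[A] A) :
    toFG m p f = (MulOpposite.op (starMap f p) : Bop A P) • m := rfl

lemma dualBasisCounit_toFG (h : ∀ p, ∑ i, c i p • e i = p) (m : M) :
    dualBasisCounit h (toFG m) = m := by
  have hone : ∑ i, (MulOpposite.op (starMap (c i) (e i)) : Bop A P) = 1 := by
    rw [← Finset.op_sum, ← MulOpposite.op_one]
    exact congrArg _ (LinearMap.ext fun p => by simpa [LinearMap.sum_apply] using h p)
  simp only [dualBasisCounit_apply, toFG_apply]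
  rw [← Finset.sum_smul, hone, one_smul]

lemma toFG_dualBasisCounit (h : ∀ p, ∑ i, c i p • e i = p)
    (φ : P →ₗ[A] ((P →ₗ[A] A) →ₗ[Bop A P] M)) : toFG (dualBasisCounit h φ) = φ :=
  LinearMap.ext fun p => LinearMap.ext fun f => op_starMap_smul_dualBasisCounit h f p φ

/-- The counit is an isomorphism `F G M ≃ M`. -/
def dualBasisCounitEquiv (h : ∀ p, ∑ i, c i p • e i = p) :
    (P →ₗ[A] ((P →ₗ[A] A) →ₗ[Bop A P] M)) ≃ₗ[Bop A P] M :=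
  { dualBasisCounit h with
    invFun := toFG
    left_inv := toFG_dualBasisCounit h
    right_inv := dualBasisCounit_toFG h }

lemma toFG_eq_starMap (h : ∀ p, ∑ i, c i p • e i = p) (f : P →ₗ[A] A)
    (x : (P →ₗ[A] A) →ₗ[Bop A P] M) : toFG (x f) = starMap f x := by
  rw [← dualBasisCounit_starMap h f x, toFG_dualBasisCounit]

variable {N : Type} [AddCommGroup N] [Module (Bop A P) N]

lemma dualBasisCounit_Fmap_Gmap (h : ∀ p, ∑ i, c i p • e i = p) (g : M →ₗ[Bop A P] N)
    (φ : P →ₗ[A] ((P →ₗ[A] A) →ₗ[Bop A P] M)) :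
    dualBasisCounit h (Fmap (Gmap g) φ) = g (dualBasisCounit h φ) :=
  (map_sum g (fun i => φ (e i) (c i)) Finset.univ).symm

lemma Gmap_bijective (h : ∀ p, ∑ i, c i p • e i = p) :
    Function.Bijective (fun g : M →ₗ[Bop A P] N => (Gmap (A := A) (P := P) g)) := by
  refine ⟨fun g g' hg => LinearMap.ext fun m => ?_, fun ψ => ?_⟩
  · replace hg : Gmap (A := A) (P := P) g = Gmap g' := hg
    rw [← dualBasisCounit_toFG h m, ← dualBasisCounit_Fmap_Gmap, hg, dualBasisCounit_Fmap_Gmap]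
  · refine ⟨dualBasisCounit h ∘ₗ Fmap ψ ∘ₗ (dualBasisCounitEquiv h).symm.toLinearMap,
      LinearMap.ext fun x => LinearMap.ext fun f => ?_⟩
    change dualBasisCounit h (Fmap ψ (toFG (x f))) = ψ x f
    rw [toFG_eq_starMap h, Fmap_starMap, dualBasisCounit_starMap]

end DualBasis

/-- `G = Hom_B(FA, −)` is fully faithful and the counit `ε_M : F G M → M`
(the unique `B`-linear map with `Φ ε_M = id`) is an isomorphism, for every `B`-module `M`. -/
theorem counit_iso_and_G_fullyFaithful
    (A : Type) [Ring A] (P : Type) [AddCommGroup P] [Module A P]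
    [Module.Finite A P] [Module.Projective A P] :
    (∀ (M N : Type) [AddCommGroup M] [Module (Bop A P) M]
        [AddCommGroup N] [Module (Bop A P) N],
      Function.Bijective
        (fun g : M →ₗ[Bop A P] N => (Gmap (A := A) (P := P) g))) ∧
    (∀ (M : Type) [AddCommGroup M] [Module (Bop A P) M],
      ∃ ε : (P →ₗ[A] ((P →ₗ[A] A) →ₗ[Bop A P] M)) →ₗ[Bop A P] M,
        PhiAdj ε = LinearMap.id ∧ Function.Bijective ε) := by
  obtain ⟨n, e, c, h⟩ := exists_finite_dual_basis (A := A) (P := P)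
  refine ⟨fun M N => Gmap_bijective h, fun M => ⟨dualBasisCounit h, ?_,
    (dualBasisCounitEquiv h).bijective⟩⟩
  exact LinearMap.ext fun x => LinearMap.ext fun f => dualBasisCounit_starMap h f x
end

section
/- Let R be a commutative ring, P• : 0 → P_0 → P_1 → ⋯ a cochain complex of flat R-modules, and M an R-module of flat dimension at most one. Then for every n ≥ 0 there is a short exact sequence 0 → H^n(P•) ⊗_R M → H^n(P• ⊗_R M) → Tor_1^R(H^{n+1}(P•), M) → 0. -/
open CategoryTheory MonoidalCategory

section UniversalCoefficients

open Limits

section Abelian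

variable {C : Type*} [Category* C] [Abelian C]

/-- An exact sequence `A ⟶ B ⟶ X ⟶ D ⟶ E` induces a short exact sequence
`0 ⟶ coker a ⟶ X ⟶ ker e ⟶ 0`. -/
theorem exists_shortExact_of_cokernel_of_kernel {A B X D E Q T : C}
    {a : A ⟶ B} {b : B ⟶ X} {d : X ⟶ D} {e : D ⟶ E}
    {hab : a ≫ b = 0} {hbd : b ≫ d = 0} {hde : d ≫ e = 0}
    (hB : (ShortComplex.mk a b hab).Exact) (hX : (ShortComplex.mk b d hbd).Exact)
    (hD : (ShortComplex.mk d e hde).Exact)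
    {q : B ⟶ Q} {haq : a ≫ q = 0} (hq : IsColimit (CokernelCofork.ofπ q haq))
    {k : T ⟶ D} {hke : k ≫ e = 0} (hk : IsLimit (KernelFork.ofι k hke)) :
    ∃ (f : Q ⟶ X) (g : X ⟶ T) (w : f ≫ g = 0),
      Mono f ∧ Epi g ∧ (ShortComplex.mk f g w).Exact := by
  obtain ⟨f, hf⟩ := CokernelCofork.IsColimit.desc' hq b hab
  obtain ⟨g, hg⟩ := KernelFork.IsLimit.lift' hk d hde
  dsimp at hf hg
  have : Epi q := Cofork.IsColimit.epi hq
  have : Mono k := Fork.IsLimit.mono hk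
  have w : f ≫ g = 0 := by
    rw [← cancel_epi q, ← cancel_mono k]
    simp [reassoc_of% hf, hg, hbd]
  refine ⟨f, g, w, ?_, ?_, ?_⟩
  · rw [Preadditive.mono_iff_cancel_zero]
    intro Z t ht
    obtain ⟨Z', π, _, s, hs⟩ := surjective_up_to_refinements_of_epi q t
    obtain ⟨Z'', π', _, s', hs'⟩ := hB.exact_up_to_refinements s
      (show s ≫ b = 0 by simp only [← hf, ← reassoc_of% hs, ht, comp_zero])
    dsimp at hs'
    rw [← cancel_epi π, ← cancel_epi π', hs, reassoc_of% hs', haq]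
    simp
  · rw [epi_iff_surjective_up_to_refinements]
    intro Z y
    obtain ⟨Z', π, hπ, x, hx⟩ := hD.exact_up_to_refinements (y ≫ k) (by simp [hke])
    refine ⟨Z', π, hπ, x, ?_⟩
    rw [← cancel_mono k, Category.assoc, Category.assoc, hg]
    exact hx
  · rw [ShortComplex.exact_iff_exact_up_to_refinements]
    intro Z x hx
    dsimp at x hx
    obtain ⟨Z', π, hπ, y, hy⟩ := hX.exact_up_to_refinements x
      (show x ≫ d = 0 by simp only [← hg, reassoc_of% hx, zero_comp])
    exact ⟨Z', π, hπ, y ≫ q, by simpa [hf] using hy⟩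

end Abelian

section Opcycles

variable {C D : Type*} [Category* C] [Category* D] [Abelian C] [Abelian D]
  (F : C ⥤ D) [F.Additive] [PreservesFiniteColimits F]
  {ι : Type*} {c : ComplexShape ι} (K : HomologicalComplex C c) (i : ι)

/-- A right exact functor commutes with `opcycles`. -/
noncomputable def mapOpcyclesIso :
    ((F.mapHomologicalComplex c).obj K).opcycles i ≅ F.obj (K.opcycles i) :=
  IsColimit.coconePointUniqueUpToIso
    (((F.mapHomologicalComplex c).obj K).opcyclesIsCokernel (c.prev i) i rfl)
    (CokernelCofork.mapIsColimit _ (K.opcyclesIsCokernel (c.prev i) i rfl) F)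

lemma pOpcycles_mapOpcyclesIso_hom :
    ((F.mapHomologicalComplex c).obj K).pOpcycles i ≫ (mapOpcyclesIso F K i).hom =
      F.map (K.pOpcycles i) :=
  IsColimit.comp_coconePointUniqueUpToIso_hom
    (((F.mapHomologicalComplex c).obj K).opcyclesIsCokernel (c.prev i) i rfl)
    (CokernelCofork.mapIsColimit _ (K.opcyclesIsCokernel (c.prev i) i rfl) F)
    WalkingParallelPair.one

lemma pOpcycles_mapOpcyclesIso_hom_assoc {Z : D} (h : F.obj (K.opcycles i) ⟶ Z) :
    ((F.mapHomologicalComplex c).obj K).pOpcycles i ≫ (mapOpcyclesIso F K i).hom ≫ h =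
      F.map (K.pOpcycles i) ≫ h :=
  (Category.assoc _ _ _).symm.trans (pOpcycles_mapOpcyclesIso_hom F K i =≫ h)

lemma mapOpcyclesIso_hom_map_fromOpcycles (j : ι) :
    (mapOpcyclesIso F K i).hom ≫ F.map (K.fromOpcycles i j) =
      ((F.mapHomologicalComplex c).obj K).fromOpcycles i j :=
  (cancel_epi (((F.mapHomologicalComplex c).obj K).pOpcycles i)).1
    ((pOpcycles_mapOpcyclesIso_hom_assoc F K i _).trans
      (((F.map_comp _ _).symm.trans (congrArg F.map (K.p_fromOpcycles i j))).trans
        (((F.mapHomologicalComplex c).obj K).p_fromOpcycles i j).symm))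

lemma mapOpcyclesIso_hom_naturality {F G : C ⥤ D} [F.Additive] [G.Additive]
    [PreservesFiniteColimits F] [PreservesFiniteColimits G] (τ : F ⟶ G) :
    HomologicalComplex.opcyclesMap ((NatTrans.mapHomologicalComplex τ c).app K) i ≫
        (mapOpcyclesIso G K i).hom =
      (mapOpcyclesIso F K i).hom ≫ τ.app (K.opcycles i) := by
  rw [← cancel_epi (((F.mapHomologicalComplex c).obj K).pOpcycles i),
    HomologicalComplex.p_opcyclesMap_assoc, pOpcycles_mapOpcyclesIso_hom,
    pOpcycles_mapOpcyclesIso_hom_assoc]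
  exact (τ.naturality (K.pOpcycles i)).symm

/-- The homology of `F(K)` in degree `i` is the kernel of `F` applied to
`K.fromOpcycles i j`, for `F` right exact. -/
lemma exists_isLimit_homology_map (j : ι) (hij : c.next i = j) :
    ∃ (k : ((F.mapHomologicalComplex c).obj K).homology i ⟶ F.obj (K.opcycles i))
      (w : k ≫ F.map (K.fromOpcycles i j) = 0), Nonempty (IsLimit (KernelFork.ofι k w)) :=
  ⟨_, _, ⟨KernelFork.isLimitOfIsLimitOfIff
    (((F.mapHomologicalComplex c).obj K).homologyIsKernel i j hij)
    (F.map (K.fromOpcycles i j)) (mapOpcyclesIso F K i)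
    (fun _ φ ↦ by rw [mapOpcyclesIso_hom_map_fromOpcycles]; rfl)⟩⟩

/-- A morphism of complexes which is mono on homology in degree `i` and mono in the next degree
is mono on `opcycles` in degree `i`. -/
lemma mono_opcyclesMap_of_mono {K L : HomologicalComplex C c} (φ : K ⟶ L) (i j : ι)
    (hij : c.next i = j) [Mono (HomologicalComplex.homologyMap φ i)] [Mono (φ.f j)] :
    Mono (HomologicalComplex.opcyclesMap φ i) := by
  rw [Preadditive.mono_iff_cancel_zero]
  intro Z t ht
  obtain ⟨s, hs⟩ := KernelFork.IsLimit.lift' (K.homologyIsKernel i j hij) t (by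
    have comm : K.fromOpcycles i j ≫ φ.f j =
        HomologicalComplex.opcyclesMap φ i ≫ L.fromOpcycles i j := by
      simp [← cancel_epi (K.pOpcycles i)]
    rw [← cancel_mono (φ.f j), Category.assoc, comm, reassoc_of% ht, zero_comp, zero_comp])
  dsimp at hs
  have : s = 0 := by
    rw [← cancel_mono (HomologicalComplex.homologyMap φ i), ← cancel_mono (L.homologyι i),
      Category.assoc, HomologicalComplex.homologyι_naturality, reassoc_of% hs, ht]
    simp
  rw [← hs, this, zero_comp]

end Opcycles


section Tensor

universe u

variable {R : Type u} [CommRing R]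

/-- The short complex of complexes obtained by tensoring a complex `P` with a short complex of
coefficient modules. -/
noncomputable abbrev tensorShortComplex {ι : Type*} {c : ComplexShape ι}
    (P : HomologicalComplex (ModuleCat.{u} R) c) (S : ShortComplex (ModuleCat.{u} R)) :
    ShortComplex (HomologicalComplex (ModuleCat.{u} R) c) where
  X₁ := ((tensorRight S.X₁).mapHomologicalComplex c).obj P
  X₂ := ((tensorRight S.X₂).mapHomologicalComplex c).obj P
  X₃ := ((tensorRight S.X₃).mapHomologicalComplex c).obj P
  f := (NatTrans.mapHomologicalComplex ((tensoringRight _).map S.f) c).app P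
  g := (NatTrans.mapHomologicalComplex ((tensoringRight _).map S.g) c).app P
  zero := by
    rw [← NatTrans.comp_app, ← NatTrans.mapHomologicalComplex_comp, ← Functor.map_comp, S.zero]
    exact HomologicalComplex.hom_ext _ _ fun i ↦ MonoidalPreadditive.whiskerLeft_zero

lemma tensorShortComplex_shortExact {ι : Type*} {c : ComplexShape ι}
    (P : HomologicalComplex (ModuleCat.{u} R) c) [∀ i, Module.Flat R (P.X i)]
    {S : ShortComplex (ModuleCat.{u} R)} (hS : S.ShortExact) :
    (tensorShortComplex P S).ShortExact :=
  HomologicalComplex.shortExact_of_degreewise_shortExact _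
    fun i ↦ hS.map_of_exact (tensorLeft (P.X i))

/-- The short complex of complexes obtained by tensoring a short complex of modules with a
complex `P`. -/
noncomputable abbrev shortComplexTensor {ι : Type*} {c : ComplexShape ι}
    (S : ShortComplex (ModuleCat.{u} R)) (P : HomologicalComplex (ModuleCat.{u} R) c) :
    ShortComplex (HomologicalComplex (ModuleCat.{u} R) c) where
  X₁ := ((tensorLeft S.X₁).mapHomologicalComplex c).obj P
  X₂ := ((tensorLeft S.X₂).mapHomologicalComplex c).obj P
  X₃ := ((tensorLeft S.X₃).mapHomologicalComplex c).obj P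
  f := (NatTrans.mapHomologicalComplex ((tensoringLeft _).map S.f) c).app P
  g := (NatTrans.mapHomologicalComplex ((tensoringLeft _).map S.g) c).app P
  zero := by
    rw [← NatTrans.comp_app, ← NatTrans.mapHomologicalComplex_comp, ← Functor.map_comp, S.zero]
    exact HomologicalComplex.hom_ext _ _ fun i ↦ MonoidalPreadditive.zero_whiskerRight

lemma shortComplexTensor_shortExact {ι : Type*} {c : ComplexShape ι}
    {S : ShortComplex (ModuleCat.{u} R)} (hS : S.ShortExact)
    (P : HomologicalComplex (ModuleCat.{u} R) c) [∀ i, Module.Flat R (P.X i)] :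
    (shortComplexTensor S P).ShortExact :=
  HomologicalComplex.shortExact_of_degreewise_shortExact _
    fun i ↦ hS.map_of_exact (tensorRight (P.X i))

lemma CategoryTheory.ProjectiveResolution.fromOpcycles_comp_π_f_zero {C : Type*} [Category* C]
    [Abelian C] {M : C} (Q : ProjectiveResolution M) :
    Q.complex.fromOpcycles 1 0 ≫ Q.π.f 0 = 0 := by
  rw [← cancel_epi (Q.complex.pOpcycles 1), HomologicalComplex.p_fromOpcycles_assoc,
    Q.complex_d_comp_π_f_zero, comp_zero]

/-- A projective resolution `Q` of `M` gives a short exact sequence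
`0 ⟶ Q.opcycles 1 ⟶ Q₀ ⟶ M ⟶ 0`. -/
lemma CategoryTheory.ProjectiveResolution.shortExact_fromOpcycles {C : Type*} [Category* C]
    [Abelian C] {M : C} (Q : ProjectiveResolution M) :
    (ShortComplex.mk (X₃ := M) (Q.complex.fromOpcycles 1 0) (Q.π.f 0)
      (Q.fromOpcycles_comp_π_f_zero)).ShortExact := by
  have hmono : Mono (Q.complex.fromOpcycles 1 0) := by
    rw [Preadditive.mono_iff_cancel_zero]
    intro Z t ht
    obtain ⟨s, hs⟩ :=
      KernelFork.IsLimit.lift' (Q.complex.homologyIsKernel 1 0 (by simp)) t ht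
    dsimp at hs
    rw [← hs, (Q.complex_exactAt_succ 0).isZero_homology.eq_of_tgt s 0, zero_comp]
  have hepi : Epi (Q.π.f 0) := inferInstance
  refine { exact := ?_, mono_f := hmono, epi_g := hepi }
  have h := (ShortComplex.mk _ _ Q.complex_d_comp_π_f_zero).exact_of_g_is_cokernel
    Q.isColimitCokernelCofork
  rw [ShortComplex.exact_iff_exact_up_to_refinements] at h ⊢
  intro A x hx
  obtain ⟨A', π, hπ, y, hy⟩ := h x hx
  exact ⟨A', π, hπ, y ≫ Q.complex.pOpcycles 1, by simpa using hy⟩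

instance {M : ModuleCat.{u} R} (Q : ProjectiveResolution M) (i : ℕ) :
    Module.Flat R (Q.complex.X i) :=
  have : Module.Projective R (Q.complex.X i) :=
    (IsProjective.iff_projective (R := R) (Q.complex.X i)).2 (Q.projective i)
  inferInstance

/-- If `Tor_2(-, M)` vanishes, the first syzygy of a projective resolution of `M` is flat. -/
lemma flat_opcycles_one {M : ModuleCat.{u} R} (Q : ProjectiveResolution M)
    (h : ∀ N : ModuleCat.{u} R, IsZero (((Tor (ModuleCat.{u} R) 2).obj N).obj M)) :
    Module.Flat R (Q.complex.opcycles 1) := by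
  rw [Module.Flat.iff_rTensor_preserves_injective_linearMap']
  intro N N' _ _ _ _ f hf
  have hmono : Mono (ModuleCat.ofHom f) := (ModuleCat.mono_iff_injective _).2 hf
  let S := ShortComplex.mk (ModuleCat.ofHom f) (cokernel.π (ModuleCat.ofHom f))
    (cokernel.condition _)
  have hS : S.ShortExact :=
    { exact := S.exact_of_g_is_cokernel (cokernelIsCokernel _)
      mono_f := hmono
      epi_g := coequalizer.π_epi }
  have hSQ := shortComplexTensor_shortExact hS Q.complex
  have : Mono (HomologicalComplex.homologyMap (shortComplexTensor S Q.complex).f 1) :=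
    (hSQ.homology_exact₁ 2 1 rfl).mono_g
      (((h S.X₃).of_iso (Q.isoLeftDerivedObj (tensorLeft S.X₃) 2).symm).eq_of_src _ _)
  have : Mono ((shortComplexTensor S Q.complex).f.f 0) :=
    (hS.map_of_exact (tensorRight (Q.complex.X 0))).mono_f
  have := mono_opcyclesMap_of_mono (shortComplexTensor S Q.complex).f 1 0 (by simp)
  have key := mapOpcyclesIso_hom_naturality Q.complex 1 ((tensoringLeft _).map S.f)
  have : Mono (S.f ▷ Q.complex.opcycles 1) := by
    have : S.f ▷ Q.complex.opcycles 1 =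
      (mapOpcyclesIso (tensorLeft S.X₁) Q.complex 1).inv ≫
        HomologicalComplex.opcyclesMap (shortComplexTensor S Q.complex).f 1 ≫
        (mapOpcyclesIso (tensorLeft S.X₂) Q.complex 1).hom :=
      (Iso.eq_inv_comp _).2 key.symm
    rw [this]
    infer_instance
  exact (ModuleCat.mono_iff_injective _).1 this

/-- Tensoring with a flat module commutes with homology, naturally in the flat module. -/
lemma homologyMap_tensorRight {ι : Type*} {c : ComplexShape ι}
    (P : HomologicalComplex (ModuleCat.{u} R) c) {K F : ModuleCat.{u} R} (φ : K ⟶ F)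
    [Module.Flat R K] [Module.Flat R F] (i : ι) :
    ∃ (e₁ : (((tensorRight K).mapHomologicalComplex c).obj P).homology i ≅ P.homology i ⊗ K)
      (e₂ : (((tensorRight F).mapHomologicalComplex c).obj P).homology i ≅ P.homology i ⊗ F),
      HomologicalComplex.homologyMap
        ((NatTrans.mapHomologicalComplex ((tensoringRight _).map φ) c).app P) i =
        e₁.hom ≫ (P.homology i ◁ φ) ≫ e₂.inv :=
  ⟨(P.sc i).mapHomologyIso (tensorRight K), (P.sc i).mapHomologyIso (tensorRight F),
    (P.sc i).homologyMap_mapNatTrans (F := tensorRight K) (G := tensorRight F)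
      ((tensoringRight _).map φ)⟩

/-- `Tor_1(N, M)` is the kernel of `N ⊗ Q.opcycles 1 ⟶ N ⊗ Q₀`, for `Q` a projective resolution
of `M`. -/
lemma exists_isLimit_tor_one {M : ModuleCat.{u} R} (Q : ProjectiveResolution M)
    (N : ModuleCat.{u} R) :
    ∃ (k : ((Tor (ModuleCat.{u} R) 1).obj N).obj M ⟶ N ⊗ Q.complex.opcycles 1)
      (w : k ≫ N ◁ Q.complex.fromOpcycles 1 0 = 0), Nonempty (IsLimit (KernelFork.ofι k w)) := by
  obtain ⟨k, hk, ⟨hk'⟩⟩ := exists_isLimit_homology_map (tensorLeft N) Q.complex 1 0 (by simp)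
  exact ⟨_, _, ⟨IsKernel.isoKernel _ _ hk' (Q.isoLeftDerivedObj (tensorLeft N) 1) rfl⟩⟩

/-- The universal coefficient sequence computed by a flat resolution `0 ⟶ S.X₁ ⟶ S.X₂` of the
coefficient module `S.X₃`, where `T` is the kernel of
`P.homology j ⊗ S.X₁ ⟶ P.homology j ⊗ S.X₂`. -/
lemma exists_shortExact_homology_tensor {ι : Type*} {c : ComplexShape ι}
    (P : HomologicalComplex (ModuleCat.{u} R) c) [∀ i, Module.Flat R (P.X i)]
    {S : ShortComplex (ModuleCat.{u} R)} (hS : S.ShortExact)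
    [Module.Flat R S.X₁] [Module.Flat R S.X₂] {i j : ι} (hij : c.Rel i j)
    {T : ModuleCat.{u} R} {k : T ⟶ P.homology j ⊗ S.X₁} {hk : k ≫ P.homology j ◁ S.f = 0}
    (hT : IsLimit (KernelFork.ofι k hk)) :
    ∃ (f : P.homology i ⊗ S.X₃ ⟶
        (((tensorRight S.X₃).mapHomologicalComplex c).obj P).homology i)
      (g : (((tensorRight S.X₃).mapHomologicalComplex c).obj P).homology i ⟶ T)
      (w : f ≫ g = 0), Mono f ∧ Epi g ∧ (ShortComplex.mk f g w).Exact := by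
  have hPS := tensorShortComplex_shortExact P hS
  obtain ⟨e₁, e₂, he⟩ := homologyMap_tensorRight P S.f i
  obtain ⟨e₁', e₂', he'⟩ := homologyMap_tensorRight P S.f j
  have hcoker := CokernelCofork.isColimitOfIsColimitOfIff
    (CokernelCofork.mapIsColimit _ hS.gIsCokernel (tensorLeft (P.homology i)))
    (HomologicalComplex.homologyMap (tensorShortComplex P S).f i) e₂ (fun W φ ↦ by
      rw [he, Category.assoc, Category.assoc, Iso.inv_hom_id_assoc,
        Preadditive.IsIso.comp_left_eq_zero e₁.hom]
      rfl)
  have hker := KernelFork.isLimitOfIsLimitOfIff hT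
    (HomologicalComplex.homologyMap (tensorShortComplex P S).f j) e₁'.symm (fun W φ ↦ by
      rw [he', Iso.symm_hom, Iso.inv_hom_id_assoc, ← Category.assoc,
        Preadditive.IsIso.comp_right_eq_zero _ e₂'.inv])
  exact exists_shortExact_of_cokernel_of_kernel (hPS.homology_exact₂ i)
    (hPS.homology_exact₃ i j hij) (hPS.homology_exact₁ i j hij) hcoker hker

end Tensor

end UniversalCoefficients

/-- **Universal coefficient theorem.**  Let `R` be a commutative ring,
`P• : 0 → P_0 → P_1 → ⋯` a cochain complex of flat `R`-modules, and `M` an `R`-module of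
flat dimension at most one (i.e. `Tor_i^R(−, M) = 0` for `i ≥ 2`).  Then for every `n ≥ 0`
there is a short exact sequence
`0 → H^n(P•) ⊗_R M → H^n(P• ⊗_R M) → Tor_1^R(H^{n+1}(P•), M) → 0`. -/
theorem universal_coefficients
    (R : Type) [CommRing R]
    (P : CochainComplex (ModuleCat R) ℕ)
    (hflat : ∀ n, Module.Flat R (P.X n))
    (M : ModuleCat R)
    (hfd : ∀ (N : ModuleCat R) (i : ℕ), 2 ≤ i →
      Limits.IsZero (((Tor (ModuleCat R) i).obj N).obj M))
    (n : ℕ) :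
    ∃ (f : (P.homology n) ⊗ M ⟶
        (((tensorRight M).mapHomologicalComplex (ComplexShape.up ℕ)).obj P).homology n)
      (g : (((tensorRight M).mapHomologicalComplex (ComplexShape.up ℕ)).obj P).homology n ⟶
        ((Tor (ModuleCat R) 1).obj (P.homology (n + 1))).obj M)
      (w : f ≫ g = 0),
      Mono f ∧ Epi g ∧ (ShortComplex.mk f g w).Exact := by
  let Q := ProjectiveResolution.of M
  have : Module.Flat R (Q.complex.opcycles 1) := flat_opcycles_one Q fun N ↦ hfd N 2 le_rfl
  obtain ⟨k, hk, ⟨hT⟩⟩ := exists_isLimit_tor_one Q (P.homology (n + 1))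
  exact exists_shortExact_homology_tensor P Q.shortExact_fromOpcycles rfl hT
end
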